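/- arXiv:1808.00181 — 2 statements merged into one kernel-verified Lean document; each statement's English description precedes it below -/
import Mathlib

section
/- Let D be a positive semidefinite n×n complex matrix and U a unitary n×n matrix. Assume that for every positive definite n×n matrix A and every Hermitian n×n matrix C with C ≥ D A⁻¹ D, the operator norm of the block matrix [[A, D], [D, C]] is at most ||A + U* C U||. Let q be an orthogonal projection matrix commuting with both D and U, and set p = I − q. Then ||D p + U* D p U|| = 2 ||D p||. -/
open scoped Matrix ComplexOrder

/-- The operator norm (largest singular value) of a square complex matrix. -/
noncomputable def opNorm {m : Type*} [Fintype m] [DecidableEq m] (M : Matrix m m ℂ) : ℝ :=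
  ‖Matrix.toEuclideanCLM (𝕜 := ℂ) M‖

open scoped MatrixOrder Matrix.Norms.L2Operator

namespace Matrix

variable {m : Type*} [Fintype m] [DecidableEq m]

lemma opNorm_eq_norm (M : Matrix m m ℂ) : opNorm M = ‖M‖ := rfl

lemma IsHermitian.posSemidef_norm_smul_one_sub {M : Matrix m m ℂ} (hM : M.IsHermitian) :
    (‖M‖ • (1 : Matrix m m ℂ) - M).PosSemidef := by
  have h := IsSelfAdjoint.le_algebraMap_norm_self (a := M) hM
  rwa [le_iff, Algebra.algebraMap_eq_smul_one] at h

lemma PosSemidef.norm_le_of_posSemidef_smul_one_sub {M : Matrix m m ℂ} (hM : M.PosSemidef) {K : ℝ}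
    (hK : 0 ≤ K) (h : (K • (1 : Matrix m m ℂ) - M).PosSemidef) : ‖M‖ ≤ K := by
  rwa [CStarAlgebra.norm_le_iff_le_algebraMap M hK hM.nonneg, le_iff,
    Algebra.algebraMap_eq_smul_one]

lemma PosSemidef.posSemidef_norm_smul_sub_mul_self {E : Matrix m m ℂ} (hE : E.PosSemidef) :
    (‖E‖ • E - E * E).PosSemidef := by
  have h := hE.1.posSemidef_norm_smul_one_sub
  have hc : Commute E (‖E‖ • (1 : Matrix m m ℂ) - E) := by
    simp [Commute, SemiconjBy, mul_sub, sub_mul]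
  have := Commute.mul_nonneg hE.nonneg h.nonneg hc
  rw [nonneg_iff_posSemidef] at this
  simpa [mul_sub] using this

lemma PosSemidef.exists_mulVec_eq_norm_smul [Nonempty m] {E : Matrix m m ℂ}
    (hE : E.PosSemidef) : ∃ x : m → ℂ, x ≠ 0 ∧ E *ᵥ x = (‖E‖ : ℂ) • x := by
  have h := CStarAlgebra.norm_mem_spectrum_of_nonneg hE.nonneg
  rw [spectrum.mem_iff, isUnit_iff_isUnit_det, isUnit_iff_ne_zero, not_not,
    ← exists_mulVec_eq_zero_iff] at h
  obtain ⟨x, hx, h⟩ := h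
  refine ⟨x, hx, ?_⟩
  rw [sub_mulVec, sub_eq_zero, Algebra.algebraMap_eq_smul_one, smul_mulVec, one_mulVec] at h
  rw [← h]
  simp

/-- The test vector `(a x, d x)` bounds the norm of the block matrix from below. -/
lemma le_norm_fromBlocks {A D C : Matrix m m ℂ} (hA : A.IsHermitian) (hD : D.IsHermitian)
    (hC : C.IsHermitian) {x : m → ℂ} (hx : x ≠ 0) {α δ γ a d : ℝ}
    (hAx : A *ᵥ x = (α : ℂ) • x) (hDx : D *ᵥ x = (δ : ℂ) • x) (hCx : C *ᵥ x = (γ : ℂ) • x) :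
    a ^ 2 * α + 2 * (a * d * δ) + d ^ 2 * γ ≤ ‖fromBlocks A D D C‖ * (a ^ 2 + d ^ 2) := by
  have hM : (fromBlocks A D D C).IsHermitian := hA.fromBlocks hD hC
  set L := ‖fromBlocks A D D C‖
  have h := hM.posSemidef_norm_smul_one_sub.dotProduct_mulVec_nonneg
    (Sum.elim ((a : ℂ) • x) ((d : ℂ) • x))
  have hxx : 0 < star x ⬝ᵥ x := dotProduct_star_self_pos_iff.mpr hx
  have key : star (Sum.elim ((a : ℂ) • x) ((d : ℂ) • x)) ⬝ᵥ
      ((L • (1 : Matrix (m ⊕ m) (m ⊕ m) ℂ) - fromBlocks A D D C) *ᵥ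
        Sum.elim ((a : ℂ) • x) ((d : ℂ) • x)) =
      ((L * (a ^ 2 + d ^ 2) - (a ^ 2 * α + 2 * (a * d * δ) + d ^ 2 * γ) : ℝ) : ℂ)
        * (star x ⬝ᵥ x) := by
    have e1 : star (Sum.elim ((a : ℂ) • x) ((d : ℂ) • x)) =
        Sum.elim ((a : ℂ) • star x) ((d : ℂ) • star x) := by
      ext i; cases i <;> simp
    have e2 : (L • (1 : Matrix (m ⊕ m) (m ⊕ m) ℂ) - fromBlocks A D D C) *ᵥ
        Sum.elim ((a : ℂ) • x) ((d : ℂ) • x) =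
        Sum.elim ((L * a - (a * α + d * δ) : ℂ) • x) ((L * d - (a * δ + d * γ) : ℂ) • x) := by
      rw [sub_mulVec, fromBlocks_mulVec, smul_mulVec, one_mulVec]
      simp only [Sum.elim_comp_inl, Sum.elim_comp_inr, mulVec_smul, hAx, hDx, hCx]
      ext i
      cases i <;> simp <;> ring
    rw [e1, e2, sumElim_dotProduct_sumElim]
    simp only [smul_dotProduct, dotProduct_smul, smul_eq_mul]
    push_cast
    ring
  rw [key, Complex.nonneg_iff, Complex.re_ofReal_mul] at h
  have := (mul_nonneg_iff_of_pos_right (Complex.pos_iff.mp hxx).1).mp h.1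
  linarith

/-- For `A = a • 1 + E` with `E ≥ 0` and `a > 0`, one has `D * A⁻¹ * D ≤ a⁻¹ • (D * D)`. -/
lemma posSemidef_sub_mul_inv_mul {D E : Matrix m m ℂ} (hD : D.IsHermitian)
    (hE : E.PosSemidef) {a : ℝ} (ha : 0 < a) (hA : (a • (1 : Matrix m m ℂ) + E).PosDef) :
    (a⁻¹ • (D * D) - D * (a • (1 : Matrix m m ℂ) + E)⁻¹ * D).PosSemidef := by
  set A := a • (1 : Matrix m m ℂ) + E with hAdef
  have hdet : IsUnit A.det := (isUnit_iff_isUnit_det A).mp hA.isUnit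
  have hEE : (E * E).PosSemidef := by
    simpa [hE.1.eq] using posSemidef_conjTranspose_mul_self E
  have h := (((hE.smul ha.le).add hEE).conjTranspose_mul_mul_same (A⁻¹ * D)).smul
    (inv_nonneg.mpr ha.le)
  convert h using 1
  have e1 : a • E + E * E = E * A := by simp [hAdef, mul_add]
  have e2 : E = A - a • 1 := by simp [hAdef]
  have hAi : (A⁻¹)ᴴ = A⁻¹ := hA.1.inv.eq
  rw [e1, conjTranspose_mul, hD.eq, hAi]
  have e3 : D * A⁻¹ * (E * A) * (A⁻¹ * D) = D * (A⁻¹ * E) * (A * A⁻¹) * D := by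
    simp only [mul_assoc]
  rw [e3, mul_nonsing_inv A hdet, e2, mul_sub, nonsing_inv_mul A hdet]
  simp [mul_sub, sub_mul, smul_sub, ha.ne']


lemma IsHermitian.posSemidef_norm_smul_projection_sub {M p : Matrix m m ℂ} (hM : M.IsHermitian)
    (hp : p.IsHermitian) (hp2 : p * p = p) (hpM : p * M * p = M) :
    (‖M‖ • p - M).PosSemidef := by
  have h := hM.posSemidef_norm_smul_one_sub.conjTranspose_mul_mul_same p
  simpa [hp.eq, mul_sub, sub_mul, hp2, hpM] using h

/-- If `p = 1 - q` is an orthogonal projection commuting with `D` and `U`, the norm of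
`D * p + t • (Uᴴ * D * D * U)` is controlled by that of `D * p + Uᴴ * (D * p) * U`. -/
lemma norm_add_smul_conj_mul_self_le {D U p q : Matrix m m ℂ} (hD : D.PosSemidef)
    (hU : Uᴴ * U = 1) (hp : p = 1 - q) (hq : q.IsHermitian) (hq2 : q * q = q) (hqD : q * D = D * q)
    (hqU : q * U = U * q) {t r : ℝ} (ht : 0 ≤ t) (ht1 : t * ‖D * p‖ ≤ 1)
    (hr : r = (1 - t * ‖D * p‖) * ‖D * p‖ + t * ‖D * p‖ *
      ‖D * p + Uᴴ * (D * p) * U‖)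
    (htr : t * ‖D * D‖ ≤ r) :
    ‖D * p + t • (Uᴴ * (D * D) * U)‖ ≤ r := by
  have hqU' : q * Uᴴ = Uᴴ * q := by
    have := congrArg conjTranspose hqU
    simpa [hq.eq, eq_comm] using this
  have hpH : p.IsHermitian := hp ▸ isHermitian_one.sub hq
  have hpp : p * p = p := by simp [hp, mul_sub, sub_mul, hq2]
  have hpD : p * D = D * p := by simp [hp, mul_sub, sub_mul, hqD]
  have hpU : p * U = U * p := by simp [hp, mul_sub, sub_mul, hqU]
  have hpU' : p * Uᴴ = Uᴴ * p := by simp [hp, mul_sub, sub_mul, hqU']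
  have hE : (D * p).PosSemidef := by
    have := hD.conjTranspose_mul_mul_same p
    rwa [hpH.eq, hpD, mul_assoc, hpp] at this
  have hEp : p * (D * p) * p = D * p := by
    rw [← mul_assoc, hpD]; simp only [mul_assoc, hpp]
  have hEE : D * p * (D * p) = D * D * p := by
    rw [mul_assoc, ← mul_assoc p, hpD]; simp only [mul_assoc, hpp]
  have hF : (Uᴴ * (D * p) * U).PosSemidef := hE.conjTranspose_mul_mul_same U
  have hFp : p * (Uᴴ * (D * p) * U) * p = Uᴴ * (D * p) * U := by
    have : p * (Uᴴ * (D * p) * U) * p = (p * Uᴴ) * (D * p) * (U * p) := by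
      simp only [mul_assoc]
    rw [this, hpU', ← hpU]
    conv_rhs => rw [← hEp]
    simp only [mul_assoc]
  have hDD : (D * D).PosSemidef := by
    simpa [hD.1.eq] using posSemidef_conjTranspose_mul_self D
  have h1 := hE.1.posSemidef_norm_smul_projection_sub hpH hpp hEp
  have h2 := (hE.add hF).1.posSemidef_norm_smul_projection_sub hpH hpp
    (by rw [mul_add, add_mul, hEp, hFp])
  have h3 := hE.posSemidef_norm_smul_sub_mul_self.conjTranspose_mul_mul_same U
  have h4 := hDD.1.posSemidef_norm_smul_one_sub.conjTranspose_mul_mul_same (U * q)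
  have h5 : q.PosSemidef := by
    simpa [hq.eq, hq2] using posSemidef_conjTranspose_mul_self q
  have hM : (D * p + t • (Uᴴ * (D * D) * U)).PosSemidef :=
    hE.add ((hDD.conjTranspose_mul_mul_same U).smul ht)
  have hr0 : 0 ≤ r := (mul_nonneg ht (norm_nonneg _)).trans htr
  refine hM.norm_le_of_posSemidef_smul_one_sub hr0 ?_
  have h := ((((h1.smul (sub_nonneg.mpr ht1)).add (h2.smul (mul_nonneg ht (norm_nonneg (D * p))))).add
    (h3.smul ht)).add (h4.smul ht)).add (h5.smul (sub_nonneg.mpr htr))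
  convert h using 1
  have e3 : Uᴴ * (‖D * p‖ • (D * p) - D * p * (D * p)) * U =
      ‖D * p‖ • (Uᴴ * (D * p) * U) - Uᴴ * (D * D) * U * p := by
    rw [hEE, mul_sub, sub_mul]
    simp only [Matrix.mul_smul, smul_mul, mul_assoc, hpU]
  have e4 : (U * q)ᴴ * (‖D * D‖ • (1 : Matrix m m ℂ) - D * D) * (U * q) =
      ‖D * D‖ • q - Uᴴ * (D * D) * U * q := by
    have e5 : q * Uᴴ * (U * q) = q := by
      rw [mul_assoc, ← mul_assoc _ U, hU, one_mul, hq2]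
    have e6 : q * Uᴴ * (D * D) * (U * q) = Uᴴ * (D * D) * U * q := by
      rw [hqU', mul_assoc Uᴴ, ← mul_assoc q, hqD, mul_assoc D, hqD, ← hqU]
      simp only [mul_assoc]
      rw [← mul_assoc q q, hq2, hqU]
    rw [conjTranspose_mul, hq.eq, mul_sub, sub_mul, e6]
    simp [e5]
  have e7 : Uᴴ * (D * D) * U = Uᴴ * (D * D) * U * p + Uᴴ * (D * D) * U * q := by
    simp [hp, mul_sub]
  have e8 : (1 : Matrix m m ℂ) = p + q := by simp [hp]
  rw [e7, e3, e4, e8]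
  subst hr
  generalize Uᴴ * (D * D) * U * p = X
  generalize Uᴴ * (D * D) * U * q = Y
  module

end Matrix

open Matrix


theorem stmt_17 {n : ℕ} (D U q : Matrix (Fin n) (Fin n) ℂ)
    (hD : D.PosSemidef) (hU : Uᴴ * U = 1)
    (h : ∀ A C : Matrix (Fin n) (Fin n) ℂ, A.PosDef → C.IsHermitian →
      (C - D * A⁻¹ * D).PosSemidef →
      opNorm (Matrix.fromBlocks A D D C) ≤ opNorm (A + Uᴴ * C * U))
    (hq : q.IsHermitian) (hq2 : q * q = q)
    (hqD : q * D = D * q) (hqU : q * U = U * q) :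
    opNorm (D * (1 - q) + Uᴴ * (D * (1 - q)) * U) = 2 * opNorm (D * (1 - q)) := by
  simp only [opNorm_eq_norm] at h ⊢
  obtain ⟨p, hp⟩ : ∃ p, p = 1 - q := ⟨_, rfl⟩
  rw [← hp]
  have hpH : p.IsHermitian := hp ▸ isHermitian_one.sub hq
  have hpp : p * p = p := by simp [hp, mul_sub, sub_mul, hq2]
  have hpD : p * D = D * p := by simp [hp, mul_sub, sub_mul, hqD]
  have hE : (D * p).PosSemidef := by
    have := hD.conjTranspose_mul_mul_same p
    rwa [hpH.eq, hpD, mul_assoc, hpp] at this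
  have hUn : U ∈ unitary (Matrix (Fin n) (Fin n) ℂ) :=
    Unitary.mem_iff.mpr ⟨hU, mul_eq_one_comm.mp hU⟩
  have hUF : ‖Uᴴ * (D * p) * U‖ = ‖D * p‖ := by
    rw [CStarRing.norm_mul_mem_unitary _ hUn,
      ← star_eq_conjTranspose, CStarRing.norm_mem_unitary_mul _ (Unitary.star_mem hUn)]
  have hle : ‖D * p + Uᴴ * (D * p) * U‖ ≤ 2 * ‖D * p‖ :=
    (norm_add_le _ _).trans (by rw [hUF]; linarith)
  refine le_antisymm hle (not_lt.mp fun hlt => ?_)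
  have hs0 : 0 ≤ ‖D * p + Uᴴ * (D * p) * U‖ := norm_nonneg _
  have hd : 0 < ‖D * p‖ := by linarith
  have hne : Nonempty (Fin n) := by
    by_contra hn
    rw [not_nonempty_iff] at hn
    simp [Subsingleton.elim (D * p) 0] at hd
  obtain ⟨x, hx, hEx⟩ := hE.exists_mulVec_eq_norm_smul
  have hdC : (‖D * p‖ : ℂ) ≠ 0 := by exact_mod_cast hd.ne'
  have hpx : p *ᵥ x = x := by
    have e : p *ᵥ ((D * p) *ᵥ x) = (D * p) *ᵥ x := by
      rw [mulVec_mulVec, ← mul_assoc, hpD, mul_assoc, hpp]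
    rw [hEx, mulVec_smul] at e
    exact smul_right_injective _ hdC e
  have hDx : D *ᵥ x = (‖D * p‖ : ℂ) • x := by
    rw [← hEx, ← mulVec_mulVec, hpx]
  have hb : 0 ≤ ‖D * D‖ := norm_nonneg _
  have key := fun t r => norm_add_smul_conj_mul_self_le (t := t) (r := r) hD hU hp hq hq2 hqD hqU
  generalize ‖D * p + Uᴴ * (D * p) * U‖ = s at *
  generalize ‖D * p‖ = d at *
  generalize ‖D * D‖ = b at *
  obtain ⟨a, ha⟩ : ∃ a, a = 2 * d + 2 * b / d + d ^ 2 / (2 * d - s) + 1 := ⟨_, rfl⟩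
  have hds : 0 < 2 * d - s := by linarith
  have hbd : 0 ≤ 2 * b / d := by positivity
  have hdd : 0 ≤ d ^ 2 / (2 * d - s) := by positivity
  have ha0 : 0 < a := by rw [ha]; positivity
  have had : 2 * d ≤ a := by linarith
  have hab : 2 * b ≤ d * a := by
    have : 2 * b / d ≤ a := by linarith
    rw [div_le_iff₀ hd] at this
    linarith
  have has : d ^ 2 < a * (2 * d - s) := by
    rw [← div_lt_iff₀ hds]
    linarith
  obtain ⟨r, hr⟩ : ∃ r, r = (1 - a⁻¹ * d) * d + a⁻¹ * d * s := ⟨_, rfl⟩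
  have hra : a * r = (a - d) * d + d * s := by rw [hr]; field_simp
  have hr2 : d ≤ 2 * r := by nlinarith
  have hupper := key a⁻¹ r (inv_nonneg.mpr ha0.le)
    (by rw [inv_mul_le_iff₀ ha0]; linarith) hr (by rw [inv_mul_le_iff₀ ha0]; nlinarith)
  have hA : (a • (1 : Matrix (Fin n) (Fin n) ℂ) + D * p).PosDef :=
    (PosDef.one.smul ha0).add_posSemidef hE
  have hC : (a⁻¹ • (D * D)).IsHermitian := by
    rw [IsHermitian, conjTranspose_smul, conjTranspose_mul, hD.1.eq]; simp
  have hL := h _ _ hA hC (posSemidef_sub_mul_inv_mul hD.1 hE ha0 hA)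
  have hR : ‖a • (1 : Matrix (Fin n) (Fin n) ℂ) + D * p + Uᴴ * (a⁻¹ • (D * D)) * U‖ ≤ a + r := by
    rw [add_assoc, Matrix.mul_smul, Matrix.smul_mul]
    refine (norm_add_le _ _).trans (add_le_add ?_ hupper)
    rw [norm_smul, CStarRing.norm_one, mul_one, Real.norm_of_nonneg ha0.le]
  have hT := le_norm_fromBlocks (α := a + d) (δ := d) (γ := a⁻¹ * d ^ 2) (a := a) (d := d)
    hA.1 hD.1 hC hx
    (by rw [add_mulVec, hEx, smul_mulVec, one_mulVec]; ext i; simp; ring) hDx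
    (by rw [smul_mulVec, ← mulVec_mulVec, hDx, mulVec_smul, hDx]; ext i; simp; ring)
  have hfin : a ^ 2 * (a + d) + 2 * (a * d * d) + d ^ 2 * (a⁻¹ * d ^ 2) ≤
      (a + r) * (a ^ 2 + d ^ 2) :=
    hT.trans (mul_le_mul_of_nonneg_right (hL.trans hR) (by positivity))
  have hrd : r * d ^ 2 ≤ d ^ 3 + d ^ 2 * (a⁻¹ * d ^ 2) := by
    have : 0 ≤ a⁻¹ * d ^ 3 * (2 * d - s) := by positivity
    rw [hr]
    linarith
  have hra2 : a ^ 2 * r = a * ((a - d) * d + d * s) := by rw [← hra]; ring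
  have hmul : d * d ^ 2 < d * (a * (2 * d - s)) := mul_lt_mul_of_pos_left has hd
  linarith
end

section
/- Let D be a positive semidefinite n×n complex matrix whose n eigenvalues are pairwise distinct, and let U be a unitary n×n matrix. Assume that for every positive definite n×n matrix A and every Hermitian n×n matrix C with C ≥ D A⁻¹ D, the operator norm of the block matrix [[A, D], [D, C]] is at most ||A + U* C U||. Then U D = D U. -/
open scoped Matrix ComplexOrder

namespace BlockNorm

lemma star_dotProduct_eq_inner {m : Type*} [Fintype m] (v w : m → ℂ) :
    star v ⬝ᵥ w = inner ℂ (WithLp.toLp 2 v) (WithLp.toLp 2 w) := by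
  rw [EuclideanSpace.inner_toLp_toLp, dotProduct_comm]

lemma re_star_dotProduct_self {m : Type*} [Fintype m] (v : m → ℂ) :
    (star v ⬝ᵥ v).re = ‖WithLp.toLp 2 v‖ ^ 2 := by
  rw [star_dotProduct_eq_inner, inner_self_eq_norm_sq_to_K]
  norm_cast

lemma re_star_dotProduct_mulVec_le {m : Type*} [Fintype m] [DecidableEq m] (M : Matrix m m ℂ)
    (v : m → ℂ) : (star v ⬝ᵥ M *ᵥ v).re ≤ opNorm M * (star v ⬝ᵥ v).re := by
  rw [re_star_dotProduct_self, star_dotProduct_eq_inner, ← Matrix.toEuclideanCLM_toLp]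
  calc _ ≤ ‖WithLp.toLp 2 v‖ * ‖Matrix.toEuclideanCLM (𝕜 := ℂ) M (WithLp.toLp 2 v)‖ :=
        re_inner_le_norm (𝕜 := ℂ) _ _
    _ ≤ ‖WithLp.toLp 2 v‖ * (‖Matrix.toEuclideanCLM (𝕜 := ℂ) M‖ * ‖WithLp.toLp 2 v‖) := by
        gcongr
        exact ContinuousLinearMap.le_opNorm _ _
    _ = _ := by rw [opNorm]; ring

open scoped MatrixOrder Matrix.Norms.L2Operator in
lemma opNorm_le_of_re_star_dotProduct_mulVec_le {m : Type*} [Fintype m] [DecidableEq m]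
    {M : Matrix m m ℂ} (hM : M.PosSemidef) {r : ℝ} (hr : 0 ≤ r)
    (h : ∀ v : m → ℂ, (star v ⬝ᵥ M *ᵥ v).re ≤ r * (star v ⬝ᵥ v).re) : opNorm M ≤ r := by
  change ‖M‖ ≤ r
  rw [CStarAlgebra.norm_le_iff_le_algebraMap M hr (Matrix.nonneg_iff_posSemidef.2 hM),
    Matrix.le_iff]
  have hH : (algebraMap ℝ (Matrix m m ℂ) r - M).IsHermitian :=
    (IsSelfAdjoint.algebraMap _ (IsSelfAdjoint.all r)).sub hM.1
  refine .of_dotProduct_mulVec_nonneg hH fun v => ?_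
  rw [Complex.nonneg_iff]
  refine ⟨?_, (hH.im_star_dotProduct_mulVec_self v).symm⟩
  have := h v
  rw [Matrix.sub_mulVec, dotProduct_sub, Algebra.algebraMap_eq_smul_one, Matrix.smul_mulVec,
    Matrix.one_mulVec, dotProduct_smul]
  simpa using this

/-- A rank one projection perturbed by `t⁻¹ • G` has its largest eigenvalue bounded, up to second
order, by the first order expansion at the eigenvector of the projection. -/
lemma norm_inner_sq_add_re_inner_le {E : Type*} [NormedAddCommGroup E] [InnerProductSpace ℂ E]
    {x : E} (hx : ‖x‖ = 1) {G : E →L[ℂ] E} (hG : ∀ u v, inner ℂ (G u) v = inner ℂ u (G v))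
    (hpos : 0 ≤ (inner ℂ x (G x)).re)
    {N t : ℝ} (hN : ‖G‖ ≤ N) (ht : 2 * N ≤ t) (ht0 : 0 < t) (z : E) :
    ‖inner ℂ x z‖ ^ 2 + (inner ℂ z (G z)).re / t ≤
      (1 + (inner ℂ x (G x)).re / t + 2 * N ^ 2 / t ^ 2) * ‖z‖ ^ 2 := by
  set a : ℂ := inner ℂ x z with ha
  obtain ⟨w, hw⟩ : ∃ w, w = z - a • x := ⟨_, rfl⟩
  have hz : z = a • x + w := by rw [hw]; abel
  have hxw : inner ℂ x w = 0 := by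
    rw [hw, inner_sub_right, inner_smul_right, inner_self_eq_norm_sq_to_K, hx]
    simp [ha]
  have hnz : ‖z‖ ^ 2 = ‖a‖ ^ 2 + ‖w‖ ^ 2 := by
    have := norm_add_sq_eq_norm_sq_add_norm_sq_of_inner_eq_zero (𝕜 := ℂ) (a • x) w
      (by rw [inner_smul_left, hxw, mul_zero])
    rw [hz, sq, this, norm_smul, hx]
    ring
  have hN0 : 0 ≤ N := (norm_nonneg _).trans hN
  have hcross : ∀ u v : E, ‖inner ℂ u (G v)‖ ≤ N * ‖u‖ * ‖v‖ := fun u v =>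
    calc _ ≤ ‖u‖ * ‖G v‖ := norm_inner_le_norm _ _
      _ ≤ ‖u‖ * (N * ‖v‖) := by gcongr; exact G.le_of_opNorm_le hN v
      _ = _ := by ring
  have hexp : (inner ℂ z (G z)).re = ‖a‖ ^ 2 * (inner ℂ x (G x)).re
      + 2 * (inner ℂ (a • x) (G w)).re + (inner ℂ w (G w)).re := by
    have h1 : (inner ℂ w (G (a • x))).re = (inner ℂ (a • x) (G w)).re := by
      rw [← hG, ← inner_conj_symm, Complex.conj_re]
    have h2 : (inner ℂ (a • x) (G (a • x))).re = ‖a‖ ^ 2 * (inner ℂ x (G x)).re := by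
      rw [map_smul, inner_smul_left, inner_smul_right, ← mul_assoc, Complex.conj_mul']
      norm_cast
      exact Complex.re_ofReal_mul _ _
    rw [hz, map_add, inner_add_left, inner_add_right, inner_add_right]
    simp only [Complex.add_re]
    rw [h1, h2]
    ring
  have h1 : (inner ℂ (a • x) (G w)).re ≤ N * ‖a‖ * ‖w‖ :=
    (Complex.re_le_norm _).trans ((hcross _ _).trans (by rw [norm_smul, hx, mul_one]))
  have h2 : (inner ℂ w (G w)).re ≤ N * ‖w‖ ^ 2 :=
    (Complex.re_le_norm _).trans ((hcross _ _).trans (by rw [sq, mul_assoc]))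
  have h3 : N / t ≤ 1 / 2 := by rw [div_le_iff₀ ht0]; linarith
  have h4 : (inner ℂ z (G z)).re / t ≤ ‖a‖ ^ 2 * ((inner ℂ x (G x)).re / t)
      + 2 * (N / t) * ‖a‖ * ‖w‖ + N / t * ‖w‖ ^ 2 := by
    rw [hexp, div_le_iff₀ ht0]
    field_simp
    linarith
  have h5 : 2 * N ^ 2 / t ^ 2 = 2 * (N / t) ^ 2 := by ring
  rw [hnz, h5]
  generalize N / t = s at *
  have hg : 0 ≤ (inner ℂ x (G x)).re / t := by positivity
  generalize (inner ℂ x (G x)).re / t = g at *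
  nlinarith [sq_nonneg (‖w‖ - 2 * s * ‖a‖), mul_nonneg hg (sq_nonneg ‖w‖),
    mul_nonneg (sq_nonneg s) (sq_nonneg ‖w‖), mul_le_mul_of_nonneg_right h3 (sq_nonneg ‖w‖)]

lemma le_of_forall_large {a g K N : ℝ}
    (h : ∀ t : ℝ, 0 < t → N ≤ t →
      t + 1 + 2 * a / t ≤ (t + 1 + g / t + K / t ^ 2) * (1 + a / t ^ 2)) : a ≤ g := by
  have hlim : Filter.Tendsto (fun t : ℝ => g + ((K + a) * t⁻¹ + a * g * t⁻¹ ^ 2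
      + a * K * t⁻¹ ^ 3)) Filter.atTop
      (nhds (g + ((K + a) * 0 + a * g * 0 ^ 2 + a * K * 0 ^ 3))) := by
    have := tendsto_inv_atTop_zero (𝕜 := ℝ)
    exact ((((this.const_mul _).add ((this.pow 2).const_mul _)).add
      ((this.pow 3).const_mul _))).const_add _
  have := ge_of_tendsto (b := a) hlim ?_
  · simpa using this
  filter_upwards [Filter.eventually_gt_atTop 0, Filter.eventually_ge_atTop N] with t ht hNt
  have h1 := mul_le_mul_of_nonneg_left (h t ht hNt) ht.le
  have e1 : t * (t + 1 + 2 * a / t) = t ^ 2 + t + 2 * a := by field_simp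
  have e2 : t * ((t + 1 + g / t + K / t ^ 2) * (1 + a / t ^ 2)) = t ^ 2 + t + a +
      (g + ((K + a) * t⁻¹ + a * g * t⁻¹ ^ 2 + a * K * t⁻¹ ^ 3)) := by
    field_simp
    ring
  rw [e1, e2] at h1
  linarith

lemma vecMulVec_star_mul_self {m : Type*} [Fintype m] {x : m → ℂ} (hx : star x ⬝ᵥ x = 1) :
    Matrix.vecMulVec x (star x) * Matrix.vecMulVec x (star x) = Matrix.vecMulVec x (star x) := by
  rw [Matrix.vecMulVec_mul_vecMulVec, hx, one_smul]

lemma inv_smul_one_add_vecMulVec {m : Type*} [Fintype m] [DecidableEq m] {x : m → ℂ}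
    (hx : star x ⬝ᵥ x = 1) {t : ℝ} (ht : 0 < t) :
    (t • (1 : Matrix m m ℂ) + Matrix.vecMulVec x (star x))⁻¹ =
      t⁻¹ • (1 : Matrix m m ℂ) - (t * (t + 1))⁻¹ • Matrix.vecMulVec x (star x) := by
  apply Matrix.inv_eq_right_inv
  rw [add_mul, mul_sub, mul_sub]
  simp only [smul_mul_assoc, mul_smul_comm, one_mul, mul_one, vecMulVec_star_mul_self hx,
    smul_smul]
  rw [inv_mul_cancel₀ ht.ne', one_smul]
  have : t⁻¹ = (t * (t + 1))⁻¹ * t + (t * (t + 1))⁻¹ := by field_simp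
  rw [this]
  rw [add_smul]
  abel

lemma re_star_dotProduct_mulVec_le_of_opNorm_fromBlocks_le {m : Type*} [Fintype m] [DecidableEq m]
    {D U : Matrix m m ℂ} (hD : D.PosSemidef)
    (h : ∀ A C : Matrix m m ℂ, A.PosDef → C.IsHermitian →
      (C - D * A⁻¹ * D).PosSemidef →
      opNorm (Matrix.fromBlocks A D D C) ≤ opNorm (A + Uᴴ * C * U))
    {x : m → ℂ} (hx : star x ⬝ᵥ x = 1) :
    (star x ⬝ᵥ (D * D) *ᵥ x).re ≤ (star x ⬝ᵥ (Uᴴ * (D * D) * U) *ᵥ x).re := by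
  have hDh : Dᴴ = D := hD.1
  have hDD : (D * D).PosSemidef := by
    simpa [hDh] using Matrix.posSemidef_conjTranspose_mul_self D
  set G := Uᴴ * (D * D) * U with hGdef
  have hG : G.PosSemidef := hDD.conjTranspose_mul_mul_same U
  set P := Matrix.vecMulVec x (star x) with hP
  have hPpos : P.PosSemidef := Matrix.posSemidef_vecMulVec_self_star x
  apply le_of_forall_large (K := 2 * opNorm G ^ 2) (N := 2 * opNorm G)
  intro t ht hNt
  set A : Matrix m m ℂ := t • 1 + P with hA
  set C : Matrix m m ℂ := t⁻¹ • (D * D) with hC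
  have hApos : A.PosDef := (Matrix.PosDef.one.smul ht).add_posSemidef hPpos
  have hCpos : C.PosSemidef := hDD.smul (by positivity)
  have hschur : (C - D * A⁻¹ * D).PosSemidef := by
    have : C - D * A⁻¹ * D = (t * (t + 1))⁻¹ • (Dᴴ * P * D) := by
      rw [hA, inv_smul_one_add_vecMulVec hx ht, hC, hDh, ← hP]
      simp [mul_sub, sub_mul]
    rw [this]
    exact (hPpos.conjTranspose_mul_mul_same D).smul (by positivity)
  have hAC : A + Uᴴ * C * U = t • 1 + P + t⁻¹ • G := by
    simp [hA, hC, hGdef]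
  have hle := h A C hApos hCpos.1 hschur
  rw [hAC] at hle
  have hg0 : 0 ≤ (star x ⬝ᵥ G *ᵥ x).re := (Complex.nonneg_iff.1 (hG.dotProduct_mulVec_nonneg x)).1
  have ha0 : 0 ≤ (star x ⬝ᵥ (D * D) *ᵥ x).re :=
    (Complex.nonneg_iff.1 (hDD.dotProduct_mulVec_nonneg x)).1
  have hxn : ‖WithLp.toLp 2 x‖ = 1 := by
    have := re_star_dotProduct_self x
    rw [hx, Complex.one_re] at this
    exact (pow_eq_one_iff_of_nonneg (norm_nonneg _) two_ne_zero).1 this.symm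
  have hupper : opNorm (t • 1 + P + t⁻¹ • G) ≤
      t + 1 + (star x ⬝ᵥ G *ᵥ x).re / t + 2 * opNorm G ^ 2 / t ^ 2 := by
    refine opNorm_le_of_re_star_dotProduct_mulVec_le
      ((Matrix.PosSemidef.one.smul ht.le).add hPpos |>.add (hG.smul (by positivity)))
      (by positivity) fun z => ?_
    have key := norm_inner_sq_add_re_inner_le hxn (G := Matrix.toEuclideanCLM (𝕜 := ℂ) G)
      (fun u v => by
        rw [← ContinuousLinearMap.adjoint_inner_right, ← ContinuousLinearMap.star_eq_adjoint,
          ← map_star, Matrix.star_eq_conjTranspose, hG.1.eq])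
      (by rw [Matrix.toEuclideanCLM_toLp, ← star_dotProduct_eq_inner]; exact hg0)
      (le_refl _) hNt ht (WithLp.toLp 2 z)
    rw [Matrix.toEuclideanCLM_toLp, Matrix.toEuclideanCLM_toLp, ← star_dotProduct_eq_inner,
      ← star_dotProduct_eq_inner, ← star_dotProduct_eq_inner, ← re_star_dotProduct_self] at key
    have hPz : (star z ⬝ᵥ P *ᵥ z).re = ‖star x ⬝ᵥ z‖ ^ 2 := by
      rw [hP, Matrix.vecMulVec_mulVec, dotProduct_smul]
      rw [show star z ⬝ᵥ x = star (star x ⬝ᵥ z) from Matrix.star_dotProduct z x]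
      rw [op_smul_eq_mul, Complex.star_def, Complex.conj_mul']
      norm_cast
    have hsplit : (star z ⬝ᵥ (t • 1 + P + t⁻¹ • G) *ᵥ z).re =
        t * (star z ⬝ᵥ z).re + ‖star x ⬝ᵥ z‖ ^ 2 + (star z ⬝ᵥ G *ᵥ z).re / t := by
      rw [← hPz, Matrix.add_mulVec, Matrix.add_mulVec, Matrix.smul_mulVec, Matrix.smul_mulVec,
        Matrix.one_mulVec, dotProduct_add, dotProduct_add, dotProduct_smul, dotProduct_smul]
      simp only [Complex.add_re, Complex.smul_re, smul_eq_mul, div_eq_inv_mul]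
    rw [hsplit]
    unfold opNorm
    linarith
  have hlower : t + 1 + 2 * (star x ⬝ᵥ (D * D) *ᵥ x).re / t ≤
      opNorm (Matrix.fromBlocks A D D C) * (1 + (star x ⬝ᵥ (D * D) *ᵥ x).re / t ^ 2) := by
    have hy : star (D *ᵥ x) = star x ᵥ* D := by rw [Matrix.star_mulVec, hDh]
    have key := re_star_dotProduct_mulVec_le (Matrix.fromBlocks A D D C)
      (Sum.elim x (t⁻¹ • D *ᵥ x))
    have hstar : star (Sum.elim x (t⁻¹ • D *ᵥ x)) = Sum.elim (star x) (t⁻¹ • star x ᵥ* D) := by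
      rw [← hy]
      ext (i | i) <;> simp
    have hAx : star x ⬝ᵥ A *ᵥ x = t + 1 := by
      rw [hA, hP, Matrix.add_mulVec, Matrix.smul_mulVec, Matrix.one_mulVec,
        Matrix.vecMulVec_mulVec, dotProduct_add, dotProduct_smul, dotProduct_smul, hx]
      simp
    have hCy : 0 ≤ (star (D *ᵥ x) ⬝ᵥ C *ᵥ (D *ᵥ x)).re :=
      (Complex.nonneg_iff.1 (hCpos.dotProduct_mulVec_nonneg _)).1
    rw [hy] at hCy
    rw [hstar, Matrix.fromBlocks_mulVec, sumElim_dotProduct_sumElim,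
      sumElim_dotProduct_sumElim] at key
    simp only [Sum.elim_comp_inl, Sum.elim_comp_inr, Matrix.mulVec_smul, dotProduct_add,
      dotProduct_smul, smul_dotProduct, hAx, hx] at key
    have e : (star x ᵥ* D) ⬝ᵥ D *ᵥ x = star x ⬝ᵥ (D * D) *ᵥ x := by
      rw [← Matrix.dotProduct_mulVec, Matrix.mulVec_mulVec]
    rw [Matrix.mulVec_mulVec, e] at key
    simp only [Complex.add_re, Complex.smul_re, Complex.ofReal_re, Complex.one_re,
      smul_eq_mul] at key
    have e2 : t⁻¹ * (t⁻¹ * (star x ⬝ᵥ (D * D) *ᵥ x).re) = (star x ⬝ᵥ (D * D) *ᵥ x).re / t ^ 2 := by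
      field_simp
    rw [e2] at key
    refine le_trans ?_ key
    have : 0 ≤ t⁻¹ * (t⁻¹ * (star x ᵥ* D ⬝ᵥ C *ᵥ D *ᵥ x).re) := by positivity
    rw [mul_div_assoc, div_eq_inv_mul]
    linarith
  exact hlower.trans (mul_le_mul_of_nonneg_right (hle.trans hupper) (by positivity))

lemma posSemidef_of_forall_unit {m : Type*} [Fintype m] {M : Matrix m m ℂ}
    (hM : M.IsHermitian)
    (h : ∀ x : m → ℂ, star x ⬝ᵥ x = 1 → 0 ≤ (star x ⬝ᵥ M *ᵥ x).re) : M.PosSemidef := by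
  refine .of_dotProduct_mulVec_nonneg hM fun z => ?_
  rw [Complex.nonneg_iff]
  refine ⟨?_, (hM.im_star_dotProduct_mulVec_self z).symm⟩
  rcases eq_or_ne z 0 with rfl | hz
  · simp
  have hr : 0 < ‖WithLp.toLp 2 z‖ := by simpa using hz
  set r := ‖WithLp.toLp 2 z‖
  have hzz : star z ⬝ᵥ z = (r : ℂ) ^ 2 := by
    rw [star_dotProduct_eq_inner, inner_self_eq_norm_sq_to_K]
    rfl
  have := h (r⁻¹ • z) (by
    rw [star_smul, smul_dotProduct, dotProduct_smul, hzz]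
    have : (r : ℂ) ≠ 0 := by exact_mod_cast hr.ne'
    simp
    field_simp)
  rw [star_smul, Matrix.mulVec_smul, smul_dotProduct, dotProduct_smul, star_trivial,
    Complex.smul_re, Complex.smul_re, smul_eq_mul, smul_eq_mul] at this
  have h2 : 0 < r⁻¹ := by positivity
  exact nonneg_of_mul_nonneg_right (nonneg_of_mul_nonneg_right this h2) h2

open scoped MatrixOrder Matrix.Norms.L2Operator in
lemma eq_of_mul_self_eq_mul_self {m : Type*} [Fintype m] [DecidableEq m] {A B : Matrix m m ℂ}
    (hA : A.PosSemidef) (hB : B.PosSemidef)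
    (h : A * A = B * B) : A = B := by
  rw [← CFC.sqrt_unique h (Matrix.nonneg_iff_posSemidef.2 hA),
    CFC.sqrt_mul_self B (Matrix.nonneg_iff_posSemidef.2 hB)]

end BlockNorm

theorem stmt_18 {n : ℕ} (D U : Matrix (Fin n) (Fin n) ℂ)
    (hD : D.PosSemidef) (hdist : Function.Injective hD.1.eigenvalues)
    (hU : Uᴴ * U = 1)
    (h : ∀ A C : Matrix (Fin n) (Fin n) ℂ, A.PosDef → C.IsHermitian →
      (C - D * A⁻¹ * D).PosSemidef →
      opNorm (Matrix.fromBlocks A D D C) ≤ opNorm (A + Uᴴ * C * U)) :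
    U * D = D * U := by
  have hU' : U * Uᴴ = 1 := mul_eq_one_comm.1 hU
  have hDD : (D * D).IsHermitian := by
    simpa [hD.1.eq] using Matrix.isHermitian_conjTranspose_mul_self D
  have hpos : (Uᴴ * (D * D) * U - D * D).PosSemidef := by
    refine BlockNorm.posSemidef_of_forall_unit
      ((Matrix.isHermitian_conjTranspose_mul_mul U hDD).sub hDD) fun x hx => ?_
    rw [Matrix.sub_mulVec, dotProduct_sub, Complex.sub_re, sub_nonneg]
    exact BlockNorm.re_star_dotProduct_mulVec_le_of_opNorm_fromBlocks_le hD h hx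
  have htr : (Uᴴ * (D * D) * U - D * D).trace = 0 := by
    rw [Matrix.trace_sub, Matrix.trace_mul_cycle, hU', one_mul, sub_self]
  have hsq : Uᴴ * (D * D) * U = D * D := sub_eq_zero.1 (hpos.trace_eq_zero_iff.1 htr)
  have heq : Uᴴ * D * U = D := by
    refine BlockNorm.eq_of_mul_self_eq_mul_self (hD.conjTranspose_mul_mul_same U) hD ?_
    calc Uᴴ * D * U * (Uᴴ * D * U) = Uᴴ * D * (U * Uᴴ) * D * U := by noncomm_ring
      _ = D * D := by rw [hU', mul_one, mul_assoc Uᴴ, hsq]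
  calc U * D = U * (Uᴴ * D * U) := by rw [heq]
    _ = U * Uᴴ * D * U := by noncomm_ring
    _ = D * U := by rw [hU', one_mul]
end
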